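/- In the blowup model, suppose Λ has uniform density κ for some κ > 0. Then the blowup-time map is strictly decreasing on positive initial values: whenever 0 < x < y, one has t_max(y) < t_max(x). In particular x ↦ t_max(x) is injective on (0,∞). (This is the abstract content of the paper's proposition that the blowup-time map t_max : π^{-1}(γ(0)) → (0,∞) is injective.) -/

import Mathlib

/-!
STATEMENT 9: In the blowup model, if `Λ` has uniform density `κ > 0`, then the
blowup-time map is strictly decreasing on positive initial values: `0 < x < y`
implies `t_max y < t_max x`; in particular `t_max` is injective on `(0,∞)`.
-/

open scoped Classical

open Set in
/-- The blowup model: magnification bounds `1 < αmin ≤ αmax`, a set `Λ ⊆ (0,∞) × (0,∞)`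
of singularities with distinct first coordinates which is finite in every box
`(0,T] × (0,H]`, and a magnification function `mag` taking values in `[αmin, αmax]`
on `Λ`. -/
structure BlowupModel where
  αmin : ℝ
  αmax : ℝ
  one_lt_αmin : 1 < αmin
  αmin_le_αmax : αmin ≤ αmax
  Λ : Set (ℝ × ℝ)
  Λ_pos : ∀ p ∈ Λ, 0 < p.1 ∧ 0 < p.2
  Λ_inj : ∀ p ∈ Λ, ∀ q ∈ Λ, p.1 = q.1 → p = q
  Λ_locFin : ∀ T H : ℝ, (Λ ∩ Set.Ioc 0 T ×ˢ Set.Ioc 0 H).Finite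
  mag : ℝ × ℝ → ℝ
  mag_mem : ∀ p ∈ Λ, αmin ≤ mag p ∧ mag p ≤ αmax

namespace BlowupModel

/-- The singularities that a section of current value `s` can hit after time `τ`. -/
def eventSet (M : BlowupModel) (τ s : ℝ) : Set (ℝ × ℝ) :=
  {p | p ∈ M.Λ ∧ τ < p.1 ∧ p.2 < s}

/-- The singularity realizing the next event after time `τ` for a section of current
value `s` (the one with least time coordinate; junk value if there is none). -/
noncomputable def nextSing (M : BlowupModel) (τ s : ℝ) : ℝ × ℝ :=
  Classical.epsilon fun p => p ∈ M.eventSet τ s ∧ ∀ q ∈ M.eventSet τ s, p.1 ≤ q.1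

/-- `evt M x n` is the pair (time of the `n`-th event, value of the section `s_x` just
after the `n`-th event), starting from `evt M x 0 = (0, x)`; at an event at the
singularity `(t,b)` the value jumps from `s` to `b + mag (t,b) * (s - b)`.  If no
further event occurs, the pair is repeated forever. -/
noncomputable def evt (M : BlowupModel) (x : ℝ) : ℕ → ℝ × ℝ
  | 0 => (0, x)
  | n + 1 =>
    let τ := (evt M x n).1
    let s := (evt M x n).2
    if (M.eventSet τ s).Nonempty then
      ((M.nextSing τ s).1,
        (M.nextSing τ s).2 + M.mag (M.nextSing τ s) * (s - (M.nextSing τ s).2))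
    else (τ, s)

/-- The blowup time of the section `s_x`: the supremum of the event times if there are
infinitely many events, and `∞` otherwise. -/
noncomputable def tmax (M : BlowupModel) (x : ℝ) : EReal :=
  if ∀ n, (M.eventSet (M.evt x n).1 (M.evt x n).2).Nonempty then
    ⨆ n, ((M.evt x n).1 : EReal)
  else ⊤

/-- The value of the section `s_x` at time `t` (meaningful for `0 ≤ t < tmax x`): the
value just after the last event at time `≤ t`. -/
noncomputable def sx (M : BlowupModel) (x t : ℝ) : ℝ :=
  sSup ((fun n => (M.evt x n).2) '' {n | (M.evt x n).1 ≤ t})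

end BlowupModel

/-- `Λ` has uniform density `κ`: for every `ε > 0` there is `A_ε > 0` such that every
box `(t, t+w] × (0, h]` with `t ≥ 0` and area `w·h ≥ A_ε` contains between
`(κ−ε)·w·h` and `(κ+ε)·w·h` singularities. -/
def BlowupModel.UniformDensity (M : BlowupModel) (κ : ℝ) : Prop :=
  ∀ ε : ℝ, 0 < ε → ∃ A : ℝ, 0 < A ∧
    ∀ t : ℝ, 0 ≤ t → ∀ w h : ℝ, 0 < w → 0 < h → A ≤ w * h →
      (κ - ε) * w * h ≤ ((M.Λ ∩ Set.Ioc t (t + w) ×ˢ Set.Ioc 0 h).ncard : ℝ) ∧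
        ((M.Λ ∩ Set.Ioc t (t + w) ×ˢ Set.Ioc 0 h).ncard : ℝ) ≤ (κ + ε) * w * h

namespace BlowupModel

lemma nextSing_spec (M : BlowupModel) (τ s : ℝ) (h : (M.eventSet τ s).Nonempty) :
    M.nextSing τ s ∈ M.eventSet τ s ∧ ∀ q ∈ M.eventSet τ s, (M.nextSing τ s).1 ≤ q.1 := by
  have hex : ∃ p, p ∈ M.eventSet τ s ∧ ∀ q ∈ M.eventSet τ s, p.1 ≤ q.1 := by
    obtain ⟨p, hp⟩ := h
    have hfin : (M.eventSet τ s ∩ {q | q.1 ≤ p.1}).Finite := by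
      refine (M.Λ_locFin p.1 s).subset ?_
      rintro q ⟨⟨h1, h2, h3⟩, h4⟩
      have := M.Λ_pos q h1
      exact ⟨h1, ⟨this.1, h4⟩, ⟨this.2, h3.le⟩⟩
    obtain ⟨a, ha, hmin⟩ := hfin.exists_minimalFor (fun q => q.1) _ ⟨p, hp, le_refl p.1⟩
    refine ⟨a, ha.1, fun q hq => ?_⟩
    by_contra hlt
    push Not at hlt
    have h5 : q.1 ≤ p.1 := hlt.le.trans ha.2
    have := hmin ⟨hq, h5⟩ hlt.le
    exact absurd this (not_le.mpr hlt)
  exact Classical.epsilon_spec hex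

/-- all the facts on the orbit -/
structure Orb (M : BlowupModel) (τ s : ℕ → ℝ) (P : ℕ → ℝ × ℝ) : Prop where
  mem : ∀ n, P n ∈ M.Λ
  tlt : ∀ n, τ n < τ (n+1)
  teq : ∀ n, τ (n+1) = (P n).1
  blt : ∀ n, (P n).2 < s n
  seq : ∀ n, s (n+1) = (P n).2 + M.mag (P n) * (s n - (P n).2)
  nxt : ∀ n, ∀ q ∈ M.Λ, τ n < q.1 → q.2 < s n → τ (n+1) ≤ q.1
  t0 : 0 ≤ τ 0

lemma orb_of (M : BlowupModel) (x : ℝ)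
    (h : ∀ n, (M.eventSet (M.evt x n).1 (M.evt x n).2).Nonempty) :
    Orb M (fun n => (M.evt x n).1) (fun n => (M.evt x n).2)
      (fun n => M.nextSing (M.evt x n).1 (M.evt x n).2) := by
  have hs : ∀ n, M.evt x (n+1) = ((M.nextSing (M.evt x n).1 (M.evt x n).2).1,
        (M.nextSing (M.evt x n).1 (M.evt x n).2).2 +
        M.mag (M.nextSing (M.evt x n).1 (M.evt x n).2) *
          ((M.evt x n).2 - (M.nextSing (M.evt x n).1 (M.evt x n).2).2)) := by
    intro n
    rw [evt]
    simp only [h n, if_true]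
  have hsp := fun n => nextSing_spec M _ _ (h n)
  refine ⟨fun n => (hsp n).1.1, fun n => ?_, fun n => ?_, fun n => (hsp n).1.2.2, fun n => ?_,
    fun n q h1 h2 h3 => ?_, ?_⟩
  · simp only [hs n]; exact (hsp n).1.2.1
  · simp only [hs n]
  · simp only [hs n]
  · simp only [hs n]; exact (hsp n).2 q ⟨h1, h2, h3⟩
  · simp [evt]

namespace Orb
variable {M : BlowupModel} {τ s : ℕ → ℝ} {P : ℕ → ℝ × ℝ}

lemma tmono (o : Orb M τ s P) : StrictMono τ := strictMono_nat_of_lt_succ o.tlt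

lemma tnn (o : Orb M τ s P) (n : ℕ) : 0 ≤ τ n := o.t0.trans (o.tmono.monotone (Nat.zero_le n))

lemma bpos (o : Orb M τ s P) (n : ℕ) : 0 < (P n).2 := (M.Λ_pos _ (o.mem n)).2

lemma spos (o : Orb M τ s P) (n : ℕ) : 0 < s n := (o.bpos n).trans (o.blt n)

lemma smono (o : Orb M τ s P) : Monotone s := by
  refine monotone_nat_of_le_succ fun n => ?_
  rw [o.seq n]
  have h1 := o.blt n
  have h2 := M.mag_mem _ (o.mem n)
  have h3 := M.one_lt_αmin
  nlinarith

lemma sup (o : Orb M τ s P) (n k : ℕ) : s (n+k) ≤ M.αmax ^ k * s n := by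
  have h3 := M.one_lt_αmin
  induction k with
  | zero => simp
  | succ k ih =>
    have h1 := o.blt (n+k)
    have h2 := M.mag_mem _ (o.mem (n+k))
    have h4 := o.bpos (n+k)
    have h5 := o.spos (n+k)
    have h6 : s (n+k+1) ≤ M.αmax * s (n+k) := by
      rw [o.seq (n+k)]
      nlinarith
    have h7 : M.αmax * s (n+k) ≤ M.αmax * (M.αmax ^ k * s n) :=
      mul_le_mul_of_nonneg_left ih (by linarith)
    calc s (n+(k+1)) ≤ _ := h6
      _ ≤ _ := h7
      _ = _ := by ring

lemma hit (o : Orb M τ s P) (n k : ℕ) (p : ℝ × ℝ) (hp : p ∈ M.Λ) (h1 : τ n < p.1)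
    (h2 : p.2 < s n) (h3 : p.1 ≤ τ (n+k)) : ∃ j, j < k ∧ P (n+j) = p := by
  induction k with
  | zero => simp at h3; linarith
  | succ k ih =>
    by_cases h : p.1 ≤ τ (n+k)
    · obtain ⟨j, hj, e⟩ := ih h
      exact ⟨j, by omega, e⟩
    · push Not at h
      refine ⟨k, by omega, M.Λ_inj _ (o.mem _) _ hp ?_⟩
      have := o.nxt (n+k) p hp h (h2.trans_le (o.smono (by omega)))
      rw [← o.teq]
      exact le_antisymm this h3

lemma boxfin (M : BlowupModel) (t w h : ℝ) (ht : 0 ≤ t) :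
    (M.Λ ∩ Set.Ioc t (t + w) ×ˢ Set.Ioc 0 h).Finite := by
  refine (M.Λ_locFin (t+w) h).subset ?_
  rintro q ⟨h1, h2, h3⟩
  exact ⟨h1, ⟨ht.trans_lt h2.1, h2.2⟩, h3⟩

lemma few (o : Orb M τ s P) (n N : ℕ) (w h : ℝ)
    (hc : (M.Λ ∩ Set.Ioc (τ n) (τ n + w) ×ˢ Set.Ioc 0 h).ncard ≤ N)
    (hb : ∀ j, j ≤ N → (P (n+j)).2 ≤ h) : τ n + w < τ (n+N+1) := by
  by_contra hlt
  push Not at hlt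
  have hinj : Function.Injective (fun j => P (n+j)) := by
    intro i j e
    have h1 : τ (n+i+1) = τ (n+j+1) := by
      rw [o.teq, o.teq]; exact congrArg Prod.fst e
    have := o.tmono.injective h1
    omega
  have hsub : (((Finset.range (N+1)).image (fun j => P (n+j)) : Finset (ℝ × ℝ)) : Set (ℝ × ℝ)) ⊆
      M.Λ ∩ Set.Ioc (τ n) (τ n + w) ×ˢ Set.Ioc 0 h := by
    intro q hq
    simp only [Finset.coe_image, Set.mem_image, Finset.coe_range, Set.mem_Iio] at hq
    obtain ⟨j, hj, rfl⟩ := hq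
    refine ⟨o.mem _, ⟨?_, ?_⟩, o.bpos _, hb j (by omega)⟩
    · rw [← o.teq]; exact o.tmono (by omega)
    · rw [← o.teq]; exact (o.tmono.monotone (by omega)).trans hlt
  have h2 := Set.ncard_le_ncard hsub (boxfin M _ _ _ (o.tnn n))
  rw [Set.ncard_coe_finset, Finset.card_image_of_injective _ hinj, Finset.card_range] at h2
  omega

lemma upper (o : Orb M τ s P) (A C q : ℝ) (hA : 0 < A) (hq : q = 1 + (M.αmin - 1)/2)
    (hC : 2 * A + C / q = C)
    (hne : ∀ t : ℝ, 0 ≤ t → ∀ w h : ℝ, 0 < w → 0 < h → A = w * h →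
      ∃ p ∈ M.Λ, t < p.1 ∧ p.1 ≤ t + w ∧ p.2 ≤ h) (k : ℕ) :
    ∀ n j, j ≤ n + k → τ j ≤ τ n + C / s n := by
  have hα := M.one_lt_αmin
  have hq1 : 1 < q := by rw [hq]; linarith
  have hC0 : 2 * A ≤ C := by
    by_contra hcon
    push Not at hcon
    have h1 : C / q < 0 := by linarith
    have h2 : C < 0 := by
      by_contra h3
      push Not at h3
      have := div_nonneg h3 (by linarith : (0:ℝ) ≤ q)
      linarith
    have h3 : C ≤ C / q := by
      rw [le_div_iff₀ (by linarith)]; nlinarith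
    linarith
  induction k using Nat.strong_induction_on with
  | _ k ih =>
  intro n j hj
  have hs := o.spos n
  obtain ⟨p, hp, hp1, hp2, hp3⟩ := hne (τ n) (o.tnn n) (2*A/s n) (s n/2) (by positivity)
    (by positivity) (by field_simp)
  have hCs : 2 * A / s n ≤ C / s n := by gcongr
  by_cases hjp : τ j ≤ p.1
  · linarith
  · push Not at hjp
    have hnj : n < j := o.tmono.lt_iff_lt.mp (hp1.trans hjp)
    obtain ⟨i, hi, e⟩ := o.hit n (j-n) p hp hp1 (by linarith) (by
      rw [Nat.add_sub_cancel' hnj.le]; exact hjp.le)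
    have ht : τ (n+i+1) = p.1 := by rw [o.teq, e]
    have hss : q * s n ≤ s (n+i+1) := by
      rw [o.seq, e]
      have h1 := M.mag_mem _ hp
      have h2 : s n ≤ s (n+i) := o.smono (by omega)
      rw [hq]
      nlinarith
    have h1 := ih (k - i - 1) (by omega) (n+i+1) j (by omega)
    have h2 : C / s (n+i+1) ≤ C / (q * s n) := by
      have : 0 ≤ C := by linarith
      gcongr
    have h3 : 2 * A / s n + C / (q * s n) = C / s n := by
      rw [← div_div, ← add_div, hC]
    linarith

lemma lower (o : Orb M τ s P) (A : ℝ) (N : ℕ) (hA : 0 < A)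
    (hup : ∀ t : ℝ, 0 ≤ t → ∀ w h : ℝ, 0 < w → 0 < h → A = w * h →
      (M.Λ ∩ Set.Ioc t (t + w) ×ˢ Set.Ioc 0 h).ncard ≤ N) (n : ℕ) :
    τ n + A / M.αmax ^ N / s n < τ (n+N+1) := by
  have hα := M.one_lt_αmin
  have hα' := M.αmin_le_αmax
  have hα0 : 0 < M.αmax := by linarith
  have hs := o.spos n
  refine o.few n N _ (M.αmax ^ N * s n) (hup _ (o.tnn n) _ _ (by positivity) (by positivity)
    (by field_simp)) fun j hj => ?_
  have h1 := o.blt (n+j)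
  have h2 := o.sup n j
  have h3 : M.αmax ^ j ≤ M.αmax ^ N := pow_le_pow_right₀ (by linarith) hj
  have h4 : M.αmax ^ j * s n ≤ M.αmax ^ N * s n := by gcongr
  linarith

lemma good (o : Orb M τ s P) (A L δ : ℝ) (N : ℕ) (hA : 0 < A) (hL : 0 < L)
    (hδ : δ * M.αmax ^ N * L = A)
    (hup : ∀ t : ℝ, 0 ≤ t → ∀ w h : ℝ, 0 < w → 0 < h → A = w * h →
      (M.Λ ∩ Set.Ioc t (t + w) ×ˢ Set.Ioc 0 h).ncard ≤ N)
    (hlo : ∀ t : ℝ, 0 ≤ t → ∀ w h : ℝ, 0 < w → 0 < h → L / 2 = w * h →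
      N + 1 < (M.Λ ∩ Set.Ioc t (t + w) ×ˢ Set.Ioc 0 h).ncard) (n : ℕ) :
    ∃ n', n ≤ n' ∧ δ * s n' ≤ (P n').2 := by
  by_contra hcon
  push Not at hcon
  have hα := M.one_lt_αmin
  have hα' := M.αmin_le_αmax
  have hα0 : 0 < M.αmax := by linarith
  have hs := o.spos n
  have hδ0 : 0 < δ := by
    by_contra h
    push Not at h
    have h1 : 0 < M.αmax ^ N * L := by positivity
    nlinarith
  have hfew := o.few n N (L / s n) (δ * M.αmax ^ N * s n)
    (hup _ (o.tnn n) _ _ (by positivity) (by positivity) (by rw [← hδ]; field_simp)) fun j hj => by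
      have h1 := hcon (n+j) (by omega)
      have h2 := o.sup n j
      have h3 : M.αmax ^ j ≤ M.αmax ^ N := pow_le_pow_right₀ (by linarith) hj
      have h4 : M.αmax ^ j * s n ≤ M.αmax ^ N * s n := by gcongr
      have h5 : δ * s (n+j) ≤ δ * (M.αmax ^ N * s n) := by
        have := h2.trans h4
        gcongr
      linarith
  have hmany := hlo _ (o.tnn n) (L / s n) (s n / 2) (by positivity) (by positivity)
    (by field_simp)
  have hsub : M.Λ ∩ Set.Ioc (τ n) (τ n + L / s n) ×ˢ Set.Ioc 0 (s n / 2) ⊆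
      (((Finset.range (N+1)).image (fun j => P (n+j)) : Finset (ℝ × ℝ)) : Set (ℝ × ℝ)) := by
    rintro q ⟨hq, ⟨h1, h2⟩, h3, h4⟩
    obtain ⟨j, hj, e⟩ := o.hit n (N+1) q hq h1 (by linarith) (h2.trans hfew.le)
    simp only [Finset.coe_image, Set.mem_image, Finset.coe_range, Set.mem_Iio]
    exact ⟨j, hj, e⟩
  have h2 := Set.ncard_le_ncard hsub (Finset.finite_toSet _)
  rw [Set.ncard_coe_finset] at h2
  have h3 := Finset.card_image_le (s := Finset.range (N+1)) (f := fun j => P (n+j))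
  rw [Finset.card_range] at h3
  omega

/-- one step of the comparison -/
lemma step (o : Orb M τ s P) {τ' s' : ℕ → ℝ} {P' : ℕ → ℝ × ℝ} (o' : Orb M τ' s' P')
    (hcof : ∀ n, ∃ m, τ n ≤ τ' m) (n m : ℕ) (r g : ℝ) (hr : 0 < r) (hg : 0 ≤ g)
    (ht : τ n = τ' m) (hd : r * s n ≤ s' m - s n)
    (hgb : g * M.αmax * s n ≤ (M.αmin - 1) * (P n).2) :
    ∃ m', τ (n+1) = τ' m' ∧ (1 + g) * r * s (n+1) ≤ s' m' - s (n+1) := by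
  have hα := M.one_lt_αmin
  have hs := o.spos n
  have hb := o.blt n
  have hb0 := o.bpos n
  have hrs : 0 < r * s n := by positivity
  obtain ⟨m1, hm1⟩ := hcof (n+1)
  have h1 : τ' m < τ' m1 := by rw [← ht]; exact (o.tlt n).trans_le hm1
  have hmm := o'.tmono.lt_iff_lt.mp h1
  obtain ⟨i, hi, e⟩ := o'.hit m (m1 - m) (P n) (o.mem n)
    (by rw [← o.teq, ← ht]; exact o.tlt n) (by linarith)
    (by rw [Nat.add_sub_cancel' hmm.le, ← o.teq]; exact hm1)
  refine ⟨m+i+1, by rw [o.teq, o'.teq, e], ?_⟩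
  rw [o'.seq, o.seq, e]
  have h2 : s' m ≤ s' (m+i) := o'.smono (by omega)
  have hm := M.mag_mem _ (o.mem n)
  set a := M.mag (P n)
  set b := (P n).2
  have h3 : a * (r * s n) ≤ a * (s' (m+i) - s n) :=
    mul_le_mul_of_nonneg_left (by linarith) (by linarith)
  have h4 : (1 + g) * (b + a * (s n - b)) ≤ a * s n := by
    have e1 : g * a * s n ≤ g * M.αmax * s n := by gcongr; exact hm.2
    have e2 : (M.αmin - 1) * b ≤ (a - 1) * b := by gcongr; exact hm.1
    have e3 : 0 ≤ g * ((a - 1) * b) := mul_nonneg hg (mul_nonneg (by linarith) hb0.le)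
    nlinarith
  have h5 := mul_le_mul_of_nonneg_left h4 hr.le
  nlinarith

end Orb

lemma key (M : BlowupModel) (κ : ℝ) (hκ : 0 < κ) (hud : M.UniformDensity κ) :
    ∃ A C c L δ q : ℝ, ∃ N : ℕ, 0 < A ∧ 0 < C ∧ 0 < L ∧ 0 < δ ∧ c = A / M.αmax ^ N ∧
    q = 1 + (M.αmin - 1)/2 ∧ 2 * A + C / q = C ∧ δ * M.αmax ^ N * L = A ∧
    (∀ t : ℝ, 0 ≤ t → ∀ w h : ℝ, 0 < w → 0 < h → A = w * h →
      ∃ p ∈ M.Λ, t < p.1 ∧ p.1 ≤ t + w ∧ p.2 ≤ h) ∧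
    (∀ t : ℝ, 0 ≤ t → ∀ w h : ℝ, 0 < w → 0 < h → A = w * h →
      (M.Λ ∩ Set.Ioc t (t + w) ×ˢ Set.Ioc 0 h).ncard ≤ N) ∧
    (∀ t : ℝ, 0 ≤ t → ∀ w h : ℝ, 0 < w → 0 < h → L / 2 = w * h →
      N + 1 < (M.Λ ∩ Set.Ioc t (t + w) ×ˢ Set.Ioc 0 h).ncard) := by
  have hα := M.one_lt_αmin
  have hα' := M.αmin_le_αmax
  have hα0 : 0 < M.αmax := by linarith
  obtain ⟨A, hA, hd⟩ := hud (κ/2) (by positivity)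
  set N : ℕ := ⌊(κ + κ/2) * A⌋₊ with hN
  set q : ℝ := 1 + (M.αmin - 1)/2 with hq
  have hq1 : 0 < q - 1 := by rw [hq]; linarith
  have hq0 : 0 < q := by linarith
  set L : ℝ := 2 * A + 4 * (N + 2) / κ with hL
  have hL0 : 0 < L := by positivity
  refine ⟨A, 2 * A * q / (q - 1), _, L, A / (M.αmax ^ N * L), q, N, hA, by positivity, hL0,
    by positivity, rfl, rfl, ?_, ?_, ?_, ?_, ?_⟩
  · field_simp; ring
  · field_simp
  · intro t ht w h hw hh e
    have h1 := (hd t ht w h hw hh e.le).1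
    have h2 : 0 < (κ - κ/2) * w * h := by
      have : 0 < κ - κ/2 := by linarith
      positivity
    have h3 : 0 < (M.Λ ∩ Set.Ioc t (t + w) ×ˢ Set.Ioc 0 h).ncard := by
      exact_mod_cast h2.trans_le h1
    obtain ⟨p, hp⟩ := Set.nonempty_of_ncard_ne_zero h3.ne'
    exact ⟨p, hp.1, hp.2.1.1, hp.2.1.2, hp.2.2.2⟩
  · intro t ht w h hw hh e
    have h1 := (hd t ht w h hw hh e.le).2
    rw [mul_assoc, ← e] at h1
    exact Nat.le_floor h1
  · intro t ht w h hw hh e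
    have h0 : 0 ≤ 4 * ((N:ℝ) + 2) / κ := by positivity
    have h1 := (hd t ht w h hw hh (by linarith)).1
    rw [mul_assoc, ← e] at h1
    have h2 : (κ - κ/2) * (L/2) = κ * A / 2 + (N + 2) := by
      rw [hL]; field_simp; ring
    have h3 : 0 < κ * A := by positivity
    have h4 : ((N + 1 : ℕ) : ℝ) < ((M.Λ ∩ Set.Ioc t (t + w) ×ˢ Set.Ioc 0 h).ncard : ℝ) := by
      push_cast; linarith
    exact_mod_cast h4

lemma all_nonempty (M : BlowupModel) (A : ℝ) (hA : 0 < A)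
    (hne : ∀ t : ℝ, 0 ≤ t → ∀ w h : ℝ, 0 < w → 0 < h → A = w * h →
      ∃ p ∈ M.Λ, t < p.1 ∧ p.1 ≤ t + w ∧ p.2 ≤ h) (x : ℝ) (hx : 0 < x) (n : ℕ) :
    (M.eventSet (M.evt x n).1 (M.evt x n).2).Nonempty := by
  have hgen : ∀ t s : ℝ, 0 ≤ t → 0 < s → (M.eventSet t s).Nonempty := by
    intro t s ht hs
    obtain ⟨p, hp, hp1, hp2, hp3⟩ := hne t ht (2*A/s) (s/2) (by positivity)
      (by positivity) (by field_simp)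
    exact ⟨p, hp, hp1, by linarith⟩
  have : 0 ≤ (M.evt x n).1 ∧ 0 < (M.evt x n).2 := by
    induction n with
    | zero => simp [evt, hx]
    | succ n ih =>
      have h := hgen _ _ ih.1 ih.2
      rw [evt]
      simp only [h, if_true]
      obtain ⟨⟨h1, h2, h3⟩, -⟩ := nextSing_spec M _ _ h
      have h4 := M.Λ_pos _ h1
      have h5 := M.mag_mem _ h1
      have h6 := M.one_lt_αmin
      refine ⟨h4.1.le, ?_⟩
      have := mul_nonneg (by linarith : 0 ≤ M.mag (M.nextSing (M.evt x n).1 (M.evt x n).2))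
        (sub_nonneg.mpr h3.le)
      linarith [h4.2]
  exact hgen _ _ this.1 this.2

lemma tmax_lt (M : BlowupModel) (κ : ℝ) (hκ : 0 < κ) (hud : M.UniformDensity κ)
    (x y : ℝ) (hx : 0 < x) (hxy : x < y) : M.tmax y < M.tmax x := by
  have hα := M.one_lt_αmin
  have hα' := M.αmin_le_αmax
  have hα0 : 0 < M.αmax := by linarith
  obtain ⟨A, C, c, L, δ, q, N, hA, hC, hL, hδ, hc, hq, hCq, hδL, hne, hup, hlo⟩ := key M κ hκ hud
  have nx := all_nonempty M A hA hne x hx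
  have ny := all_nonempty M A hA hne y (hx.trans hxy)
  have ox := orb_of M x nx
  have oy := orb_of M y ny
  have ex : M.tmax x = ⨆ n, ((M.evt x n).1 : EReal) := if_pos nx
  have ey : M.tmax y = ⨆ n, ((M.evt y n).1 : EReal) := if_pos ny
  have hx0 : (M.evt x 0).2 = x ∧ (M.evt x 0).1 = 0 := by simp [evt]
  have hy0 : (M.evt y 0).2 = y ∧ (M.evt y 0).1 = 0 := by simp [evt]
  set τ := fun n => (M.evt x n).1 with hτ
  set s := fun n => (M.evt x n).2 with hs
  set τ' := fun n => (M.evt y n).1 with hτ'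
  set s' := fun n => (M.evt y n).2 with hs'
  have hc0 : 0 < c := by rw [hc]; positivity
  by_contra hcon
  push Not at hcon
  have lex : ∀ n, (τ n : EReal) ≤ M.tmax x := fun n => by
    rw [ex]; exact le_iSup (fun n => ((M.evt x n).1 : EReal)) n
  have hcof : ∀ n, ∃ m, τ n ≤ τ' m := by
    intro n
    by_contra h
    push Not at h
    have h1 : M.tmax y ≤ (τ n : EReal) := by
      rw [ey]; exact iSup_le fun m => EReal.coe_le_coe_iff.mpr (h m).le
    have h2 := lex (n+1)
    have h3 := EReal.coe_le_coe_iff.mp ((h2.trans hcon).trans h1)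
    exact absurd (ox.tlt n) (not_lt.mpr h3)
  set g := (M.αmin - 1) * δ / M.αmax with hg
  have hg0 : 0 < g := by
    have : 0 < M.αmin - 1 := by linarith
    positivity
  set r0 := (y - x) / x with hr0
  have hr00 : 0 < r0 := div_pos (by linarith) hx
  have prop : ∀ (r : ℝ), 0 < r → ∀ n m, τ n = τ' m → r * s n ≤ s' m - s n → ∀ k,
      ∃ m', τ (n+k) = τ' m' ∧ r * s (n+k) ≤ s' m' - s (n+k) := by
    intro r hr n m h1 h2 k
    induction k with
    | zero => exact ⟨m, h1, h2⟩
    | succ k ih =>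
      obtain ⟨m', h3, h4⟩ := ih
      have h5 := ox.bpos (n+k)
      obtain ⟨m2, h6, h7⟩ := ox.step oy hcof (n+k) m' r 0 hr le_rfl h3 h4 (by
        have := mul_pos (sub_pos.mpr hα) h5
        simpa using this.le)
      exact ⟨m2, h6, by rw [add_zero, one_mul] at h7; exact h7⟩
  have grow : ∀ k : ℕ, ∃ n m, τ n = τ' m ∧ (1+g)^k * r0 * s n ≤ s' m - s n := by
    intro k
    induction k with
    | zero =>
      refine ⟨0, 0, ?_, ?_⟩
      · simp only [hτ, hτ', hx0.2, hy0.2]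
      · simp only [hs, hs', hx0.1, hy0.1, hr0]
        rw [pow_zero, one_mul, div_mul_cancel₀ _ hx.ne']
    | succ k ih =>
      obtain ⟨n, m, h1, h2⟩ := ih
      obtain ⟨n', hn', hb⟩ := ox.good A L δ N hA hL hδL hup hlo n
      have hrpos : 0 < (1+g)^k * r0 := by positivity
      obtain ⟨m', h3, h4⟩ := prop _ hrpos n m h1 h2 (n' - n)
      rw [Nat.add_sub_cancel' hn'] at h3 h4
      obtain ⟨m2, h6, h7⟩ := ox.step oy hcof n' m' _ g hrpos hg0.le h3 h4 (by
        have e : g * M.αmax * s n' = (M.αmin - 1) * (δ * s n') := by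
          rw [hg]; field_simp
        rw [e]
        exact mul_le_mul_of_nonneg_left hb (by linarith))
      exact ⟨n'+1, m2, h6, by rw [pow_succ']; linarith⟩
  obtain ⟨k, hk⟩ := pow_unbounded_of_one_lt (C / c / r0) (by linarith : 1 < 1 + g)
  obtain ⟨n, m, h1, h2⟩ := grow k
  have hsx := ox.spos n
  have hsy := oy.spos m
  have hU : M.tmax y ≤ ((τ' m + C / s' m : ℝ) : EReal) := by
    rw [ey]
    refine iSup_le fun j => EReal.coe_le_coe_iff.mpr ?_
    exact oy.upper A C q hA hq hCq hne j m j (by omega)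
  have hLo := ox.lower A N hA hup n
  rw [← hc] at hLo
  have h3 := EReal.coe_le_coe_iff.mp (((lex (n+N+1)).trans hcon).trans hU)
  have h4 : c / s n < C / s' m := by linarith
  rw [div_lt_div_iff₀ hsx hsy] at h4
  rw [div_div, div_lt_iff₀ (by positivity)] at hk
  have h5 : c * ((1+g)^k * r0 * s n) ≤ c * s' m := 
    mul_le_mul_of_nonneg_left (by linarith) hc0.le
  nlinarith

end BlowupModel

theorem statement9 (M : BlowupModel) (κ : ℝ) (hκ : 0 < κ) (hud : M.UniformDensity κ) :
    (∀ x y : ℝ, 0 < x → x < y → M.tmax y < M.tmax x) ∧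
      Set.InjOn M.tmax (Set.Ioi 0) := by
  have h := BlowupModel.tmax_lt M κ hκ hud
  refine ⟨h, fun x hx y hy e => ?_⟩
  rcases lt_trichotomy x y with hl | hl | hl
  · exact absurd e (h x y hx hl).ne'
  · exact hl
  · exact absurd e (h y x hy hl).ne
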